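/- arXiv:2107.10594 — 2 statements merged into one kernel-verified Lean document; each statement's English description precedes it below -/
import Mathlib

section
/- Let c₀ > 1. There exist ν₀ ∈ (0,1], c > 0 and C > 1, depending only on c₀, with the following property: for every ν with 0 < ν < ν₀, every real α with |α| ≥ c₀, and every rapidly decaying solution θ of the transport fractional-diffusion mode system with viscosity ν at wave number α, one has Σ_β |θ(t,β)|² ≤ C² e^{−2c ν^{2/3} t} Σ_β |θ(0,β)|² for all t ≥ 0. -/
/-- `S(β) = (α² + β²)^{1/2}`. -/
noncomputable def Sv (α : ℝ) (β : ℤ) : ℝ := Real.sqrt (α ^ 2 + (β : ℝ) ^ 2)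

/-- A family `θ : ℝ → ℤ → ℂ` is rapidly decaying if for every `k ∈ ℕ` and `T > 0`,
`sup_{0 ≤ t ≤ T} Σ_β (1+β²)^k |θ(t,β)|² < ∞`. -/
def RapidlyDecaying (θ : ℝ → ℤ → ℂ) : Prop :=
  ∀ k : ℕ, ∀ T : ℝ, 0 < T → ∃ M : ℝ, ∀ t : ℝ, 0 ≤ t → t ≤ T →
    Summable (fun β : ℤ => (1 + (β : ℝ) ^ 2) ^ k * ‖θ t β‖ ^ 2) ∧
    (∑' β : ℤ, (1 + (β : ℝ) ^ 2) ^ k * ‖θ t β‖ ^ 2) ≤ M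

/-- The transport fractional-diffusion mode system with viscosity `ν` at wave number `α`:
`d/dt θ(t,β) = −ν S(β) θ(t,β) − (i α/2)[θ(t,β−1) + θ(t,β+1)]`. -/
def TransportFracDiff (α ν : ℝ) (θ : ℝ → ℤ → ℂ) : Prop :=
  ∀ t : ℝ, ∀ β : ℤ,
    HasDerivAt (fun s => θ s β)
      (-((ν * Sv α β : ℝ) : ℂ) * θ t β
        - Complex.I * (α : ℂ) / 2 * (θ t (β - 1) + θ t (β + 1))) t

open Set

def Dec (u : ℝ → ℤ → ℝ) : Prop :=
  ∀ k : ℕ, ∃ M : ℝ, 0 ≤ M ∧ ∀ τ ∈ Icc (0 : ℝ) 1, ∀ β : ℤ, (1 + |(β : ℝ)|) ^ k * |u τ β| ≤ M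

def Tmp (u : ℝ → ℤ → ℝ) : Prop :=
  ∃ K : ℝ, ∃ j : ℕ, 0 ≤ K ∧ ∀ τ ∈ Icc (0 : ℝ) 1, ∀ β : ℤ, |u τ β| ≤ K * (1 + |(β : ℝ)|) ^ j

lemma one_le_w (β : ℤ) : (1 : ℝ) ≤ 1 + |(β : ℝ)| := by
  have := abs_nonneg (β : ℝ)
  linarith

lemma Dec.tmp {u : ℝ → ℤ → ℝ} (h : Dec u) : Tmp u := by
  obtain ⟨M, hM, h⟩ := h 0
  exact ⟨M, 0, hM, fun τ hτ β => by simpa using h τ hτ β⟩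

lemma Dec.add {u v : ℝ → ℤ → ℝ} (hu : Dec u) (hv : Dec v) : Dec (fun τ β => u τ β + v τ β) := by
  intro k
  obtain ⟨M, hM, h⟩ := hu k
  obtain ⟨M', hM', h'⟩ := hv k
  refine ⟨M + M', by positivity, fun τ hτ β => ?_⟩
  have h1 := h τ hτ β
  have h2 := h' τ hτ β
  have h3 : (1 + |(β : ℝ)|) ^ k * |u τ β + v τ β|
      ≤ (1 + |(β : ℝ)|) ^ k * (|u τ β| + |v τ β|) := by
    gcongr
    exact abs_add_le _ _
  linarith

lemma Dec.neg {u : ℝ → ℤ → ℝ} (hu : Dec u) : Dec (fun τ β => - u τ β) := by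
  intro k
  obtain ⟨M, hM, h⟩ := hu k
  exact ⟨M, hM, fun τ hτ β => by simpa using h τ hτ β⟩

lemma Dec.sub {u v : ℝ → ℤ → ℝ} (hu : Dec u) (hv : Dec v) : Dec (fun τ β => u τ β - v τ β) := by
  simpa [sub_eq_add_neg] using hu.add hv.neg

lemma Dec.tmul {u v : ℝ → ℤ → ℝ} (hu : Tmp u) (hv : Dec v) : Dec (fun τ β => u τ β * v τ β) := by
  intro k
  obtain ⟨K, j, hK, h⟩ := hu
  obtain ⟨M, hM, h'⟩ := hv (k + j)
  refine ⟨K * M, by positivity, fun τ hτ β => ?_⟩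
  have h1 := h τ hτ β
  have h2 := h' τ hτ β
  calc (1 + |(β : ℝ)|) ^ k * |u τ β * v τ β|
      = (1 + |(β : ℝ)|) ^ k * (|u τ β| * |v τ β|) := by rw [abs_mul]
    _ ≤ (1 + |(β : ℝ)|) ^ k * ((K * (1 + |(β : ℝ)|) ^ j) * |v τ β|) := by gcongr
    _ = K * ((1 + |(β : ℝ)|) ^ (k + j) * |v τ β|) := by rw [pow_add]; ring
    _ ≤ K * M := by gcongr

lemma Dec.mult {u v : ℝ → ℤ → ℝ} (hu : Dec u) (hv : Tmp v) : Dec (fun τ β => u τ β * v τ β) := by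
  simpa [mul_comm] using Dec.tmul hv hu

lemma Dec.sq {u : ℝ → ℤ → ℝ} (hu : Dec u) : Dec (fun τ β => u τ β ^ 2) := by
  simpa [pow_two] using Dec.tmul hu.tmp hu

lemma Dec.shift {u : ℝ → ℤ → ℝ} (hu : Dec u) (j : ℤ) : Dec (fun τ β => u τ (β + j)) := by
  intro k
  obtain ⟨M, hM, h⟩ := hu k
  refine ⟨(1 + |(j : ℝ)|) ^ k * M, by positivity, fun τ hτ β => ?_⟩
  have h1 := h τ hτ (β + j)
  have h2 : 1 + |(β : ℝ)| ≤ (1 + |(j : ℝ)|) * (1 + |((β + j : ℤ) : ℝ)|) := by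
    push_cast
    have e : |(β : ℝ)| ≤ |(β : ℝ) + j| + |(j : ℝ)| := by
      have := abs_sub (β + j : ℝ) j
      simpa using this
    nlinarith [abs_nonneg (j : ℝ), abs_nonneg (β + j : ℝ)]
  calc (1 + |(β : ℝ)|) ^ k * |u τ (β + j)|
      ≤ ((1 + |(j : ℝ)|) * (1 + |((β + j : ℤ) : ℝ)|)) ^ k * |u τ (β + j)| := by gcongr
    _ = (1 + |(j : ℝ)|) ^ k * ((1 + |((β + j : ℤ) : ℝ)|) ^ k * |u τ (β + j)|) := by
        rw [mul_pow]; ring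
    _ ≤ _ := by gcongr

lemma Dec.sp {u : ℝ → ℤ → ℝ} (hu : Dec u) : Dec (fun τ β => u τ (β + 1)) := hu.shift 1

lemma Dec.sm {u : ℝ → ℤ → ℝ} (hu : Dec u) : Dec (fun τ β => u τ (β - 1)) := hu.shift (-1)

lemma Tmp.add {u v : ℝ → ℤ → ℝ} (hu : Tmp u) (hv : Tmp v) : Tmp (fun τ β => u τ β + v τ β) := by
  obtain ⟨K, j, hK, h⟩ := hu
  obtain ⟨K', j', hK', h'⟩ := hv
  refine ⟨K + K', j + j', by positivity, fun τ hτ β => ?_⟩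
  have h1 := h τ hτ β
  have h2 := h' τ hτ β
  have e1 : (1 + |(β : ℝ)|) ^ j ≤ (1 + |(β : ℝ)|) ^ (j + j') :=
    pow_le_pow_right₀ (one_le_w β) (by omega)
  have e2 : (1 + |(β : ℝ)|) ^ j' ≤ (1 + |(β : ℝ)|) ^ (j + j') :=
    pow_le_pow_right₀ (one_le_w β) (by omega)
  have := abs_add_le (u τ β) (v τ β)
  nlinarith [mul_le_mul_of_nonneg_left e1 hK, mul_le_mul_of_nonneg_left e2 hK']

lemma Tmp.neg {u : ℝ → ℤ → ℝ} (hu : Tmp u) : Tmp (fun τ β => - u τ β) := by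
  obtain ⟨K, j, hK, h⟩ := hu
  exact ⟨K, j, hK, fun τ hτ β => by simpa using h τ hτ β⟩

lemma Tmp.sub {u v : ℝ → ℤ → ℝ} (hu : Tmp u) (hv : Tmp v) : Tmp (fun τ β => u τ β - v τ β) := by
  simpa [sub_eq_add_neg] using hu.add hv.neg

lemma Tmp.mul {u v : ℝ → ℤ → ℝ} (hu : Tmp u) (hv : Tmp v) : Tmp (fun τ β => u τ β * v τ β) := by
  obtain ⟨K, j, hK, h⟩ := hu
  obtain ⟨K', j', hK', h'⟩ := hv
  refine ⟨K * K', j + j', by positivity, fun τ hτ β => ?_⟩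
  have h1 := h τ hτ β
  have h2 := h' τ hτ β
  rw [abs_mul, pow_add]
  calc |u τ β| * |v τ β| ≤ (K * (1 + |(β : ℝ)|) ^ j) * (K' * (1 + |(β : ℝ)|) ^ j') := by gcongr
    _ = _ := by ring

lemma Tmp.sq {u : ℝ → ℤ → ℝ} (hu : Tmp u) : Tmp (fun τ β => u τ β ^ 2) := by
  simpa [pow_two] using hu.mul hu

lemma Tmp.const (a : ℝ) : Tmp (fun _ _ => a) :=
  ⟨|a|, 0, abs_nonneg a, fun τ _ β => by simp⟩

lemma Tmp.cast : Tmp (fun _ β => (β : ℝ)) :=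
  ⟨1, 1, by norm_num, fun τ _ β => by simp⟩

lemma Tmp.shift {u : ℝ → ℤ → ℝ} (hu : Tmp u) (i : ℤ) : Tmp (fun τ β => u τ (β + i)) := by
  obtain ⟨K, j, hK, h⟩ := hu
  refine ⟨K * (1 + |(i : ℝ)|) ^ j, j, by positivity, fun τ hτ β => ?_⟩
  have h2 : 1 + |((β + i : ℤ) : ℝ)| ≤ (1 + |(i : ℝ)|) * (1 + |(β : ℝ)|) := by
    push_cast
    nlinarith [abs_nonneg (i : ℝ), abs_nonneg (β : ℝ), abs_add_le (β : ℝ) i]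
  calc |u τ (β + i)| ≤ K * (1 + |((β + i : ℤ) : ℝ)|) ^ j := h τ hτ (β + i)
    _ ≤ K * ((1 + |(i : ℝ)|) * (1 + |(β : ℝ)|)) ^ j := by gcongr
    _ = _ := by rw [mul_pow]; ring

lemma Tmp.sp {u : ℝ → ℤ → ℝ} (hu : Tmp u) : Tmp (fun τ β => u τ (β + 1)) := hu.shift 1

lemma Tmp.sm {u : ℝ → ℤ → ℝ} (hu : Tmp u) : Tmp (fun τ β => u τ (β - 1)) := hu.shift (-1)

lemma summable_w : Summable (fun β : ℤ => ((1 + |(β : ℝ)|) ^ 2)⁻¹) := by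
  have h : Summable (fun n : ℕ => (((n : ℝ) + 1) ^ 2)⁻¹) := by
    have := (summable_nat_add_iff 1).2 (Real.summable_nat_pow_inv.2 (by norm_num : 1 < 2))
    simpa using this
  refine Summable.of_nat_of_neg ?_ ?_
  · simpa [add_comm] using h
  · simpa [add_comm] using h

lemma Dec.bound {u : ℝ → ℤ → ℝ} (hu : Dec u) : ∃ M : ℝ, ∀ τ ∈ Icc (0 : ℝ) 1, ∀ β : ℤ,
    |u τ β| ≤ M * ((1 + |(β : ℝ)|) ^ 2)⁻¹ := by
  obtain ⟨M, hM, h⟩ := hu 2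
  refine ⟨M, fun τ hτ β => ?_⟩
  have h1 := h τ hτ β
  have h0 : 0 < (1 + |(β : ℝ)|) ^ 2 := by positivity
  rw [← div_eq_mul_inv, le_div_iff₀ h0]
  linarith

lemma Dec.summable {u : ℝ → ℤ → ℝ} (hu : Dec u) {τ : ℝ} (hτ : τ ∈ Icc (0 : ℝ) 1) :
    Summable (u τ) := by
  obtain ⟨M, h⟩ := hu.bound
  exact Summable.of_norm_bounded (summable_w.mul_left M) (fun β => by simpa using h τ hτ β)

lemma tsum_deriv {f f' : ℝ → ℤ → ℝ} (hf : Dec f) (hf' : Dec f')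
    (hd : ∀ τ β, HasDerivAt (fun s => f s β) (f' τ β) τ) :
    ContinuousOn (fun τ => ∑' β, f τ β) (Icc 0 1) ∧
    ∀ τ ∈ Ioo (0 : ℝ) 1, HasDerivAt (fun τ => ∑' β, f τ β) (∑' β, f' τ β) τ := by
  constructor
  · obtain ⟨M, h⟩ := hf.bound
    refine continuousOn_tsum (u := fun β : ℤ => M * ((1 + |(β : ℝ)|) ^ 2)⁻¹) ?_
      (summable_w.mul_left M) ?_
    · intro β τ _
      exact (hd τ β).continuousAt.continuousWithinAt
    · intro β τ hτ
      simpa using h τ hτ β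
  · intro τ hτ
    obtain ⟨M, h⟩ := hf'.bound
    exact hasDerivAt_tsum_of_isPreconnected (summable_w.mul_left M) isOpen_Ioo isPreconnected_Ioo
      (fun β s _ => hd s β) (fun β s hs => by simpa using h s (Ioo_subset_Icc_self hs) β) hτ
      (hf.summable (Ioo_subset_Icc_self hτ)) hτ

lemma tsum_shift (u : ℤ → ℝ) (j : ℤ) : ∑' β, u (β + j) = ∑' β, u β :=
  (Equiv.addRight j).tsum_eq u

lemma tsum_tele {f : ℤ → ℝ} {g w : ℝ → ℤ → ℝ} (hg : Dec g) (hw : Dec w) {τ : ℝ}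
    (hτ : τ ∈ Icc (0 : ℝ) 1) (h : ∀ β, f β = g τ β + (w τ β - w τ (β + 1))) :
    ∑' β, f β = ∑' β, g τ β := by
  have e : f = fun β => g τ β + (w τ β - w τ (β + 1)) := funext h
  have h1 := hg.summable hτ
  have h2 := hw.summable hτ
  have h3 := (hw.sp).summable hτ
  rw [e, h1.tsum_add (h2.sub h3), h2.tsum_sub h3, tsum_shift (w τ) 1]
  ring

def dg (x : ℝ → ℤ → ℝ) : ℝ → ℤ → ℝ := fun τ β => x τ (β - 1) - x τ (β + 1)

lemma Dec.dg {x : ℝ → ℤ → ℝ} (h : Dec x) : Dec (dg x) := h.sm.sub h.sp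

structure Sys (δ σ : ℝ) (S : ℤ → ℝ) (x y : ℝ → ℤ → ℝ) : Prop where
  hδ : 0 < δ
  hδ1 : δ ≤ 1
  hσ : σ * σ = 1
  S1 : ∀ β, 1 ≤ S β
  Sβ : ∀ β : ℤ, |(β : ℝ)| ≤ S β
  Sp : ∀ β : ℤ, |S (β + 1) - S β| ≤ 1
  Sm : ∀ β : ℤ, |S (β - 1) - S β| ≤ 1
  St : Tmp (fun _ β => S β)
  hx : Dec x
  hy : Dec y
  dx : ∀ τ β, HasDerivAt (fun s => x s β)
    (-δ * S β * x τ β + σ / (2 * δ ^ 2) * (y τ (β - 1) + y τ (β + 1))) τ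
  dy : ∀ τ β, HasDerivAt (fun s => y s β)
    (-δ * S β * y τ β - σ / (2 * δ ^ 2) * (x τ (β - 1) + x τ (β + 1))) τ

noncomputable def sN (x y : ℝ → ℤ → ℝ) (τ : ℝ) : ℝ := ∑' β : ℤ, (x τ β ^ 2 + y τ β ^ 2)
noncomputable def sP (x y : ℝ → ℤ → ℝ) (τ : ℝ) : ℝ :=
  ∑' β : ℤ, (β : ℝ) ^ 2 * (x τ β ^ 2 + y τ β ^ 2)
noncomputable def sY (x y : ℝ → ℤ → ℝ) (τ : ℝ) : ℝ :=
  ∑' β : ℤ, (β : ℝ) * (dg y τ β * x τ β - dg x τ β * y τ β)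
noncomputable def sG (x y : ℝ → ℤ → ℝ) (τ : ℝ) : ℝ := ∑' β : ℤ, (dg x τ β ^ 2 + dg y τ β ^ 2)
noncomputable def sN1 (S : ℤ → ℝ) (x y : ℝ → ℤ → ℝ) (τ : ℝ) : ℝ :=
  ∑' β : ℤ, S β * (x τ β ^ 2 + y τ β ^ 2)
noncomputable def sP1 (S : ℤ → ℝ) (x y : ℝ → ℤ → ℝ) (τ : ℝ) : ℝ :=
  ∑' β : ℤ, S β * ((β : ℝ) ^ 2 * (x τ β ^ 2 + y τ β ^ 2))
noncomputable def sG1 (S : ℤ → ℝ) (x y : ℝ → ℤ → ℝ) (τ : ℝ) : ℝ :=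
  ∑' β : ℤ, S β * (dg x τ β ^ 2 + dg y τ β ^ 2)
noncomputable def sR1 (S : ℤ → ℝ) (x y : ℝ → ℤ → ℝ) (τ : ℝ) : ℝ :=
  ∑' β : ℤ, -(β : ℝ) * ((S (β - 1) * y τ (β - 1) - S (β + 1) * y τ (β + 1)) * x τ β
    + dg y τ β * S β * x τ β - (S (β - 1) * x τ (β - 1) - S (β + 1) * x τ (β + 1)) * y τ β
    - dg x τ β * S β * y τ β)
noncomputable def sR2 (S : ℤ → ℝ) (x y : ℝ → ℤ → ℝ) (τ : ℝ) : ℝ :=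
  ∑' β : ℤ, (-2) * (((S (β - 1) - S β) * x τ (β - 1) - (S (β + 1) - S β) * x τ (β + 1)) * dg x τ β
    + ((S (β - 1) - S β) * y τ (β - 1) - (S (β + 1) - S β) * y τ (β + 1)) * dg y τ β)

section
variable {δ σ : ℝ} {S : ℤ → ℝ} {x y : ℝ → ℤ → ℝ}

lemma Sys.derivN (h : Sys δ σ S x y) :
    ContinuousOn (sN x y) (Icc 0 1) ∧
    ∀ τ ∈ Ioo (0 : ℝ) 1, HasDerivAt (sN x y) (-2 * δ * sN1 S x y τ) τ := by
  have hx := h.hx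
  have hy := h.hy
  have hxm := hx.sm
  have hym := hy.sm
  have hxp := hx.sp
  have hyp := hy.sp
  have hS := h.St
  have tx := hx.tmp
  have ty := hy.tmp
  obtain ⟨hc, hd⟩ := tsum_deriv (f := fun τ β => x τ β ^ 2 + y τ β ^ 2)
    (f' := fun τ β => 2 * x τ β * (-δ * S β * x τ β + σ / (2 * δ ^ 2) * (y τ (β - 1) + y τ (β + 1)))
      + 2 * y τ β * (-δ * S β * y τ β - σ / (2 * δ ^ 2) * (x τ (β - 1) + x τ (β + 1))))
    (hx.sq.add hy.sq)
    (by repeat' first | assumption | exact Tmp.const _ | with_reducible apply Dec.sub | with_reducible apply Dec.add | with_reducible apply Dec.neg | with_reducible apply Dec.tmul | with_reducible apply Tmp.mul)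
    (by
      intro τ β
      have := ((h.dx τ β).pow 2).add ((h.dy τ β).pow 2)
      exact this.congr_deriv (by push_cast; ring))
  refine ⟨hc, fun τ hτ => ?_⟩
  have hI := Ioo_subset_Icc_self hτ
  refine (hd τ hτ).congr_deriv ?_
  refine (tsum_tele (g := fun τ β => (-2 * δ) * (S β * (x τ β ^ 2 + y τ β ^ 2)))
    (w := fun τ β => (σ / (δ ^ 2)) * (x τ β * y τ (β - 1) - y τ β * x τ (β - 1)))
    (Dec.tmul (Tmp.const _) (Dec.tmul hS (hx.sq.add hy.sq)))
    (Dec.tmul (Tmp.const _) ((Dec.tmul tx hym).sub (Dec.tmul ty hxm))) hI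
    (by
      intro β
      simp only [add_sub_cancel_right]
      have := h.hδ.ne'
      field_simp
      ring)).trans ?_
  rw [tsum_mul_left]
  rfl

lemma Sys.derivP (h : Sys δ σ S x y) :
    ContinuousOn (sP x y) (Icc 0 1) ∧
    ∀ τ ∈ Ioo (0 : ℝ) 1, HasDerivAt (sP x y)
      (-2 * δ * sP1 S x y τ + σ / δ ^ 2 * sY x y τ) τ := by
  have hx := h.hx
  have hy := h.hy
  have hxm := hx.sm
  have hym := hy.sm
  have hxp := hx.sp
  have hyp := hy.sp
  have hS := h.St
  have tx := hx.tmp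
  have ty := hy.tmp
  have tgx := hx.dg.tmp
  have tgy := hy.dg.tmp
  obtain ⟨hc, hd⟩ := tsum_deriv (f := fun τ β => (β : ℝ) ^ 2 * (x τ β ^ 2 + y τ β ^ 2))
    (f' := fun τ β => (β : ℝ) ^ 2 * (2 * x τ β * (-δ * S β * x τ β + σ / (2 * δ ^ 2) * (y τ (β - 1) + y τ (β + 1)))
      + 2 * y τ β * (-δ * S β * y τ β - σ / (2 * δ ^ 2) * (x τ (β - 1) + x τ (β + 1)))))
    (Dec.tmul Tmp.cast.sq (hx.sq.add hy.sq))
    (by repeat' first | assumption | exact Tmp.const _ | exact Tmp.cast.sq | with_reducible apply Dec.sub | with_reducible apply Dec.add | with_reducible apply Dec.neg | with_reducible apply Dec.tmul | with_reducible apply Tmp.mul)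
    (by
      intro τ β
      have := (((h.dx τ β).pow 2).add ((h.dy τ β).pow 2)).const_mul ((β : ℝ) ^ 2)
      exact this.congr_deriv (by push_cast; ring))
  refine ⟨hc, fun τ hτ => ?_⟩
  have hI := Ioo_subset_Icc_self hτ
  refine (hd τ hτ).congr_deriv ?_
  have d1 : Dec (fun τ β => (-2 * δ) * (S β * ((β : ℝ) ^ 2 * (x τ β ^ 2 + y τ β ^ 2)))) :=
    Dec.tmul (Tmp.const _) (Dec.tmul hS (Dec.tmul Tmp.cast.sq (hx.sq.add hy.sq)))
  have d2 : Dec (fun τ β => σ / δ ^ 2 * ((β : ℝ) * (dg y τ β * x τ β - dg x τ β * y τ β))) :=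
    Dec.tmul (Tmp.const _) (Dec.tmul Tmp.cast ((Dec.tmul tgy hx).sub (Dec.tmul tgx hy)))
  refine (tsum_tele (g := fun τ β => (-2 * δ) * (S β * ((β : ℝ) ^ 2 * (x τ β ^ 2 + y τ β ^ 2)))
      + σ / δ ^ 2 * ((β : ℝ) * (dg y τ β * x τ β - dg x τ β * y τ β)))
    (w := fun τ β => (σ / (δ ^ 2)) * (((β : ℝ) * ((β : ℝ) - 1)) * (x τ β * y τ (β - 1) - y τ β * x τ (β - 1))))
    (d1.add d2)
    (Dec.tmul (Tmp.const _) (Dec.tmul (Tmp.mul Tmp.cast (Tmp.cast.sub (Tmp.const 1)))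
      ((Dec.tmul tx hym).sub (Dec.tmul ty hxm)))) hI
    (by
      intro β
      simp only [add_sub_cancel_right, dg]
      have := h.hδ.ne'
      push_cast
      field_simp
      ring)).trans ?_
  rw [(d1.summable hI).tsum_add (d2.summable hI), tsum_mul_left, tsum_mul_left]
  rfl

lemma dgderivx (h : Sys δ σ S x y) (τ : ℝ) (β : ℤ) : HasDerivAt (fun s => dg x s β)
    (-δ * (S (β - 1) * x τ (β - 1) - S (β + 1) * x τ (β + 1))
      + σ / (2 * δ ^ 2) * (dg y τ (β - 1) + dg y τ (β + 1))) τ := by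
  have := (h.dx τ (β - 1)).sub (h.dx τ (β + 1))
  refine this.congr_deriv ?_
  simp only [dg, add_sub_cancel_right, sub_add_cancel]
  ring

lemma dgderivy (h : Sys δ σ S x y) (τ : ℝ) (β : ℤ) : HasDerivAt (fun s => dg y s β)
    (-δ * (S (β - 1) * y τ (β - 1) - S (β + 1) * y τ (β + 1))
      - σ / (2 * δ ^ 2) * (dg x τ (β - 1) + dg x τ (β + 1))) τ := by
  have := (h.dy τ (β - 1)).sub (h.dy τ (β + 1))
  refine this.congr_deriv ?_
  simp only [dg, add_sub_cancel_right, sub_add_cancel]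
  ring

lemma Sys.derivY (h : Sys δ σ S x y) :
    ContinuousOn (sY x y) (Icc 0 1) ∧
    ∀ τ ∈ Ioo (0 : ℝ) 1, HasDerivAt (sY x y)
      (σ / (2 * δ ^ 2) * sG x y τ + δ * sR1 S x y τ) τ := by
  have hx := h.hx
  have hy := h.hy
  have hxm := hx.sm
  have hym := hy.sm
  have hxp := hx.sp
  have hyp := hy.sp
  have hS := h.St
  have hSp := h.St.sp
  have hSm := h.St.sm
  have tx := hx.tmp
  have ty := hy.tmp
  have gx := hx.dg
  have gy := hy.dg
  have gxm := gx.sm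
  have gym := gy.sm
  have gxp := gx.sp
  have gyp := gy.sp
  have tgx := hx.dg.tmp
  have tgy := hy.dg.tmp
  have cst := @Tmp.cast
  obtain ⟨hc, hd⟩ := tsum_deriv (f := fun τ β => (β : ℝ) * (dg y τ β * x τ β - dg x τ β * y τ β))
    (f' := fun τ β => (β : ℝ) * (((-δ * (S (β - 1) * y τ (β - 1) - S (β + 1) * y τ (β + 1))
      - σ / (2 * δ ^ 2) * (dg x τ (β - 1) + dg x τ (β + 1))) * x τ β + dg y τ β *
        (-δ * S β * x τ β + σ / (2 * δ ^ 2) * (y τ (β - 1) + y τ (β + 1)))) -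
      ((-δ * (S (β - 1) * x τ (β - 1) - S (β + 1) * x τ (β + 1))
      + σ / (2 * δ ^ 2) * (dg y τ (β - 1) + dg y τ (β + 1))) * y τ β + dg x τ β *
        (-δ * S β * y τ β - σ / (2 * δ ^ 2) * (x τ (β - 1) + x τ (β + 1))))))
    (by repeat' first | assumption | exact Tmp.const _ | with_reducible apply Dec.sub | with_reducible apply Dec.add | with_reducible apply Dec.neg | with_reducible apply Dec.tmul | with_reducible apply Tmp.mul)
    (by repeat' first | assumption | exact Tmp.const _ | with_reducible apply Dec.sub | with_reducible apply Dec.add | with_reducible apply Dec.neg | with_reducible apply Dec.tmul | with_reducible apply Tmp.mul | with_reducible apply Tmp.sub | with_reducible apply Tmp.add | with_reducible apply Dec.tmp)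
    (by
      intro τ β
      have := (((dgderivy h τ β).mul (h.dx τ β)).sub ((dgderivx h τ β).mul (h.dy τ β))).const_mul (β : ℝ)
      exact this)
  refine ⟨hc, fun τ hτ => ?_⟩
  have hI := Ioo_subset_Icc_self hτ
  refine (hd τ hτ).congr_deriv ?_
  have d1 : Dec (fun τ β => σ / (2 * δ ^ 2) * (dg x τ β ^ 2 + dg y τ β ^ 2)) :=
    Dec.tmul (Tmp.const _) (gx.sq.add gy.sq)
  have d2 : Dec (fun τ β => δ * (-(β : ℝ) * ((S (β - 1) * y τ (β - 1) - S (β + 1) * y τ (β + 1)) * x τ β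
    + dg y τ β * S β * x τ β - (S (β - 1) * x τ (β - 1) - S (β + 1) * x τ (β + 1)) * y τ β
    - dg x τ β * S β * y τ β))) := by
    repeat' first | assumption | exact Tmp.const _ | with_reducible apply Dec.sub | with_reducible apply Dec.add | with_reducible apply Dec.neg | with_reducible apply Dec.tmul | with_reducible apply Tmp.mul | with_reducible apply Tmp.sub | with_reducible apply Tmp.add | with_reducible apply Tmp.neg | with_reducible apply Dec.tmp
  refine (tsum_tele (g := fun τ β => σ / (2 * δ ^ 2) * (dg x τ β ^ 2 + dg y τ β ^ 2) +
      δ * (-(β : ℝ) * ((S (β - 1) * y τ (β - 1) - S (β + 1) * y τ (β + 1)) * x τ β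
    + dg y τ β * S β * x τ β - (S (β - 1) * x τ (β - 1) - S (β + 1) * x τ (β + 1)) * y τ β
    - dg x τ β * S β * y τ β)))
    (w := fun τ β => σ / (2 * δ ^ 2) * ((((β : ℝ) - 1) * dg x τ β * x τ (β - 1)
      - (β : ℝ) * dg x τ (β - 1) * x τ β) + (((β : ℝ) - 1) * dg y τ β * y τ (β - 1)
      - (β : ℝ) * dg y τ (β - 1) * y τ β)))
    (d1.add d2)
    (by repeat' first | assumption | exact Tmp.const _ | with_reducible apply Dec.sub | with_reducible apply Dec.add | with_reducible apply Dec.neg | with_reducible apply Dec.tmul | with_reducible apply Tmp.mul | with_reducible apply Tmp.sub | with_reducible apply Tmp.add | with_reducible apply Dec.tmp) hI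
    (by
      intro β
      simp only [add_sub_cancel_right, sub_add_cancel, dg]
      push_cast
      ring)).trans ?_
  rw [(d1.summable hI).tsum_add (d2.summable hI), tsum_mul_left, tsum_mul_left]
  rfl

lemma Sys.derivG (h : Sys δ σ S x y) :
    ContinuousOn (sG x y) (Icc 0 1) ∧
    ∀ τ ∈ Ioo (0 : ℝ) 1, HasDerivAt (sG x y)
      (-2 * δ * sG1 S x y τ + δ * sR2 S x y τ) τ := by
  have hx := h.hx
  have hy := h.hy
  have hxm := hx.sm
  have hym := hy.sm
  have hxp := hx.sp
  have hyp := hy.sp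
  have hS := h.St
  have hSp := h.St.sp
  have hSm := h.St.sm
  have gx := hx.dg
  have gy := hy.dg
  have gxm := gx.sm
  have gym := gy.sm
  have gxp := gx.sp
  have gyp := gy.sp
  have tgx := hx.dg.tmp
  have tgy := hy.dg.tmp
  obtain ⟨hc, hd⟩ := tsum_deriv (f := fun τ β => dg x τ β ^ 2 + dg y τ β ^ 2)
    (f' := fun τ β => 2 * dg x τ β * (-δ * (S (β - 1) * x τ (β - 1) - S (β + 1) * x τ (β + 1))
      + σ / (2 * δ ^ 2) * (dg y τ (β - 1) + dg y τ (β + 1)))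
      + 2 * dg y τ β * (-δ * (S (β - 1) * y τ (β - 1) - S (β + 1) * y τ (β + 1))
      - σ / (2 * δ ^ 2) * (dg x τ (β - 1) + dg x τ (β + 1))))
    (gx.sq.add gy.sq)
    (by repeat' first | assumption | exact Tmp.const _ | with_reducible apply Dec.sub | with_reducible apply Dec.add | with_reducible apply Dec.neg | with_reducible apply Dec.tmul | with_reducible apply Tmp.mul)
    (by
      intro τ β
      have := ((dgderivx h τ β).pow 2).add ((dgderivy h τ β).pow 2)
      exact this.congr_deriv (by push_cast; ring))
  refine ⟨hc, fun τ hτ => ?_⟩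
  have hI := Ioo_subset_Icc_self hτ
  refine (hd τ hτ).congr_deriv ?_
  have d1 : Dec (fun τ β => (-2 * δ) * (S β * (dg x τ β ^ 2 + dg y τ β ^ 2))) :=
    Dec.tmul (Tmp.const _) (Dec.tmul hS (gx.sq.add gy.sq))
  have d2 : Dec (fun τ β => δ * ((-2) * (((S (β - 1) - S β) * x τ (β - 1) - (S (β + 1) - S β) * x τ (β + 1)) * dg x τ β
    + ((S (β - 1) - S β) * y τ (β - 1) - (S (β + 1) - S β) * y τ (β + 1)) * dg y τ β))) := by
    repeat' first | assumption | exact Tmp.const _ | with_reducible apply Dec.sub | with_reducible apply Dec.add | with_reducible apply Dec.neg | with_reducible apply Dec.tmul | with_reducible apply Tmp.mul | with_reducible apply Tmp.sub | with_reducible apply Tmp.add | with_reducible apply Tmp.neg | with_reducible apply Dec.tmp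
  refine (tsum_tele (g := fun τ β => (-2 * δ) * (S β * (dg x τ β ^ 2 + dg y τ β ^ 2)) +
      δ * ((-2) * (((S (β - 1) - S β) * x τ (β - 1) - (S (β + 1) - S β) * x τ (β + 1)) * dg x τ β
    + ((S (β - 1) - S β) * y τ (β - 1) - (S (β + 1) - S β) * y τ (β + 1)) * dg y τ β)))
    (w := fun τ β => (σ / (δ ^ 2)) * (dg x τ β * dg y τ (β - 1) - dg y τ β * dg x τ (β - 1)))
    (d1.add d2)
    (by repeat' first | assumption | exact Tmp.const _ | with_reducible apply Dec.sub | with_reducible apply Dec.add | with_reducible apply Dec.neg | with_reducible apply Dec.tmul | with_reducible apply Tmp.mul) hI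
    (by
      intro β
      simp only [add_sub_cancel_right, dg, sub_add_cancel]
      have := h.hδ.ne'
      field_simp
      ring)).trans ?_
  rw [(d1.summable hI).tsum_add (d2.summable hI), tsum_mul_left, tsum_mul_left]
  rfl
end

lemma young {μ ρ : ℝ} (hμ : 0 < μ) (h : μ * ρ = 1) (a b : ℝ) : 2 * a * b ≤ μ * a ^ 2 + ρ * b ^ 2 := by
  have e : μ * a ^ 2 + ρ * b ^ 2 - 2 * a * b = μ * (a - ρ * b) ^ 2 := by
    linear_combination (2 * a * b - ρ * b ^ 2) * h
  nlinarith [mul_nonneg hμ.le (sq_nonneg (a - ρ * b))]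

lemma cab {c t : ℝ} (h : |c| ≤ t) (a b : ℝ) : c * a * b ≤ t / 2 * (a ^ 2 + b ^ 2) := by
  have h1 := abs_le.1 h
  nlinarith [mul_nonneg (by linarith : 0 ≤ t + c) (sq_nonneg (a - b)),
    mul_nonneg (by linarith : 0 ≤ t - c) (sq_nonneg (a + b))]

lemma Dec.tsum_le {f g : ℝ → ℤ → ℝ} (hf : Dec f) (hg : Dec g) {τ : ℝ}
    (hτ : τ ∈ Icc (0 : ℝ) 1) (h : ∀ β, f τ β ≤ g τ β) : ∑' β, f τ β ≤ ∑' β, g τ β :=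
  Summable.tsum_le_tsum h (hf.summable hτ) (hg.summable hτ)

section
variable {δ σ : ℝ} {S : ℤ → ℝ} {x y : ℝ → ℤ → ℝ}

lemma Sys.dN (h : Sys δ σ S x y) : Dec (fun τ β => x τ β ^ 2 + y τ β ^ 2) := h.hx.sq.add h.hy.sq
lemma Sys.dP (h : Sys δ σ S x y) : Dec (fun τ β => (β : ℝ) ^ 2 * (x τ β ^ 2 + y τ β ^ 2)) :=
  Dec.tmul Tmp.cast.sq h.dN
lemma Sys.dG (h : Sys δ σ S x y) : Dec (fun τ β => dg x τ β ^ 2 + dg y τ β ^ 2) :=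
  h.hx.dg.sq.add h.hy.dg.sq
lemma Sys.dN1 (h : Sys δ σ S x y) : Dec (fun τ β => S β * (x τ β ^ 2 + y τ β ^ 2)) :=
  Dec.tmul h.St h.dN
lemma Sys.dP1 (h : Sys δ σ S x y) :
    Dec (fun τ β => S β * ((β : ℝ) ^ 2 * (x τ β ^ 2 + y τ β ^ 2))) :=
  Dec.tmul h.St h.dP
lemma Sys.dG1 (h : Sys δ σ S x y) : Dec (fun τ β => S β * (dg x τ β ^ 2 + dg y τ β ^ 2)) :=
  Dec.tmul h.St h.dG
lemma Dec.c {f : ℝ → ℤ → ℝ} (hf : Dec f) (a : ℝ) : Dec (fun τ β => a * f τ β) :=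
  Dec.tmul (Tmp.const a) hf

lemma Sys.leY (h : Sys δ σ S x y) {s μ ρ τ : ℝ} (hs : s * s = 1) (hμ : 0 < μ) (hr : μ * ρ = 1)
    (hI : τ ∈ Icc (0 : ℝ) 1) : 2 * (s * sY x y τ) ≤ μ * sP x y τ + ρ * sG x y τ := by
  have hx := h.hx
  have hy := h.hy
  have tgx := hx.dg.tmp
  have tgy := hy.dg.tmp
  have d0 : Dec (fun τ β => (β : ℝ) * (dg y τ β * x τ β - dg x τ β * y τ β)) :=
    Dec.tmul Tmp.cast ((Dec.tmul tgy hx).sub (Dec.tmul tgx hy))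
  have := Dec.tsum_le ((d0.c s).c 2) ((h.dP.c μ).add (h.dG.c ρ)) hI (by
    intro β
    have h1 := young hμ hr (s * β * x τ β) (dg y τ β)
    have h2 := young hμ hr (s * β * y τ β) (-dg x τ β)
    have e1 : (s * β * x τ β) ^ 2 = β ^ 2 * x τ β ^ 2 := by
      linear_combination (β ^ 2 * x τ β ^ 2) * hs
    have e2 : (s * β * y τ β) ^ 2 = β ^ 2 * y τ β ^ 2 := by
      linear_combination (β ^ 2 * y τ β ^ 2) * hs
    rw [e1] at h1
    rw [e2] at h2
    linear_combination h1 + h2)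
  rw [((h.dP.c μ).summable hI).tsum_add ((h.dG.c ρ).summable hI)] at this
  simp only [tsum_mul_left] at this
  exact this

lemma Sys.leP (h : Sys δ σ S x y) {μ ρ τ : ℝ} (hμ : 0 < μ) (hr : μ * ρ = 1)
    (hI : τ ∈ Icc (0 : ℝ) 1) : 2 * sP x y τ ≤ μ * sN1 S x y τ + ρ * sP1 S x y τ := by
  have := Dec.tsum_le (h.dP.c 2) ((h.dN1.c μ).add (h.dP1.c ρ)) hI (by
    intro β
    have hρ : 0 < ρ := by
      by_contra hn
      nlinarith
    have h1 := young hμ hr 1 |(β : ℝ)|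
    have h2 := h.Sβ β
    have h0 := abs_nonneg (β : ℝ)
    have h3 : (β : ℝ) ^ 2 = |(β : ℝ)| ^ 2 := by simp
    rw [h3]
    have h4 : 2 * |(β : ℝ)| ^ 2 ≤ S β * (μ + ρ * |(β : ℝ)| ^ 2) := by
      nlinarith [mul_le_mul_of_nonneg_left h1 h0, mul_nonneg (sub_nonneg.2 h2)
        (by positivity : 0 ≤ μ + ρ * |(β : ℝ)| ^ 2)]
    have hq : 0 ≤ x τ β ^ 2 + y τ β ^ 2 := by positivity
    nlinarith [mul_le_mul_of_nonneg_right h4 hq])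
  rw [((h.dN1.c μ).summable hI).tsum_add ((h.dP1.c ρ).summable hI)] at this
  simp only [tsum_mul_left] at this
  exact this

lemma Sys.leR1 (h : Sys δ σ S x y) {s μ ρ τ : ℝ} (hs : s * s = 1) (hμ : 0 < μ) (hr : μ * ρ = 1)
    (hI : τ ∈ Icc (0 : ℝ) 1) :
    s * sR1 S x y τ ≤ μ * sP1 S x y τ + ρ * sG1 S x y τ + 3 * sN1 S x y τ := by
  have hx := h.hx
  have hy := h.hy
  have hxm := hx.sm
  have hym := hy.sm
  have hxp := hx.sp
  have hyp := hy.sp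
  have hS := h.St
  have hSp := h.St.sp
  have hSm := h.St.sm
  have gx := hx.dg
  have gy := hy.dg
  have cst := @Tmp.cast
  have d0 : Dec (fun τ β => s * (-(β : ℝ) * ((S (β - 1) * y τ (β - 1) - S (β + 1) * y τ (β + 1)) * x τ β
    + dg y τ β * S β * x τ β - (S (β - 1) * x τ (β - 1) - S (β + 1) * x τ (β + 1)) * y τ β
    - dg x τ β * S β * y τ β))) := by
    repeat' first | assumption | exact Tmp.const _ | with_reducible apply Dec.add | with_reducible apply Dec.sub | with_reducible apply Dec.tmul | with_reducible apply Tmp.mul | with_reducible apply Tmp.add | with_reducible apply Tmp.sub | with_reducible apply Tmp.neg | with_reducible apply Dec.tmp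
  have da := (h.dP1.c μ).add (h.dG1.c ρ)
  have db := (h.dN1.add h.dN1.sm).add h.dN1.sp
  have hs1 : |s| = 1 := by
    have : |s| * |s| = 1 := by rw [← abs_mul, hs, abs_one]
    nlinarith [abs_nonneg s]
  have := Dec.tsum_le d0 (da.add db) hI (by
    intro β
    have h1 := young hμ hr (s * β * x τ β) (-dg y τ β)
    have h2 := young hμ hr (s * β * y τ β) (dg x τ β)
    have e1 : (s * β * x τ β) ^ 2 = β ^ 2 * x τ β ^ 2 := by
      linear_combination (β ^ 2 * x τ β ^ 2) * hs
    have e2 : (s * β * y τ β) ^ 2 = β ^ 2 * y τ β ^ 2 := by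
      linear_combination (β ^ 2 * y τ β ^ 2) * hs
    rw [e1] at h1
    rw [e2] at h2
    have h0 := abs_nonneg (β : ℝ)
    have S1 := h.S1 β
    have h3 := mul_le_mul_of_nonneg_left (add_le_add h1 h2) (by linarith : 0 ≤ S β)
    have cm : |s * β * (S (β - 1) - S β)| ≤ |(β : ℝ)| := by
      rw [abs_mul, abs_mul, hs1]
      nlinarith [h.Sm β]
    have cp : |s * β * (S (β + 1) - S β)| ≤ |(β : ℝ)| := by
      rw [abs_mul, abs_mul, hs1]
      nlinarith [h.Sp β]
    have k1 := cab cm (-y τ (β - 1)) (x τ β)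
    have k2 := cab cp (y τ (β + 1)) (x τ β)
    have k3 := cab cm (x τ (β - 1)) (y τ β)
    have k4 := cab cp (-x τ (β + 1)) (y τ β)
    have b0 := h.Sβ β
    have bm : |(β : ℝ)| ≤ 2 * S (β - 1) := by
      have t1 := h.Sβ (β - 1)
      have t2 := h.S1 (β - 1)
      push_cast at t1
      have t3 := abs_add_le ((β : ℝ) - 1) 1
      simp only [sub_add_cancel, abs_one] at t3
      linarith
    have bp : |(β : ℝ)| ≤ 2 * S (β + 1) := by
      have t1 := h.Sβ (β + 1)
      have t2 := h.S1 (β + 1)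
      push_cast at t1
      have t3 := abs_sub ((β : ℝ) + 1) 1
      simp only [add_sub_cancel_right, abs_one] at t3
      linarith
    have l1 := mul_le_mul_of_nonneg_right b0 (by positivity : 0 ≤ x τ β ^ 2 + y τ β ^ 2)
    have l2 := mul_le_mul_of_nonneg_right bm (by positivity : 0 ≤ x τ (β - 1) ^ 2 + y τ (β - 1) ^ 2)
    have l3 := mul_le_mul_of_nonneg_right bp (by positivity : 0 ≤ x τ (β + 1) ^ 2 + y τ (β + 1) ^ 2)
    have e3 : s * (-(β : ℝ) * ((S (β - 1) * y τ (β - 1) - S (β + 1) * y τ (β + 1)) * x τ β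
      + dg y τ β * S β * x τ β - (S (β - 1) * x τ (β - 1) - S (β + 1) * x τ (β + 1)) * y τ β
      - dg x τ β * S β * y τ β)) = S β * (2 * (s * β * x τ β) * (-dg y τ β) +
        2 * (s * β * y τ β) * dg x τ β) + s * β * (S (β - 1) - S β) * (-y τ (β - 1)) * x τ β
        + s * β * (S (β + 1) - S β) * (y τ (β + 1)) * x τ β
        + s * β * (S (β - 1) - S β) * (x τ (β - 1)) * y τ β
        + s * β * (S (β + 1) - S β) * (-x τ (β + 1)) * y τ β := by
      simp only [dg]
      ring
    rw [e3]
    linarith)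
  rw [(da.summable hI).tsum_add (db.summable hI),
    ((h.dP1.c μ).summable hI).tsum_add ((h.dG1.c ρ).summable hI),
    ((h.dN1.add h.dN1.sm).summable hI).tsum_add (h.dN1.sp.summable hI),
    (h.dN1.summable hI).tsum_add (h.dN1.sm.summable hI)] at this
  have em : ∑' β, S (β - 1) * (x τ (β - 1) ^ 2 + y τ (β - 1) ^ 2) = sN1 S x y τ :=
    tsum_shift (fun β => S β * (x τ β ^ 2 + y τ β ^ 2)) (-1)
  have ep : ∑' β, S (β + 1) * (x τ (β + 1) ^ 2 + y τ (β + 1) ^ 2) = sN1 S x y τ :=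
    tsum_shift (fun β => S β * (x τ β ^ 2 + y τ β ^ 2)) 1
  rw [em, ep] at this
  simp only [tsum_mul_left] at this
  change s * sR1 S x y τ ≤ μ * sP1 S x y τ + ρ * sG1 S x y τ + (sN1 S x y τ + sN1 S x y τ + sN1 S x y τ) at this
  linarith

lemma Sys.leR2 (h : Sys δ σ S x y) {μ ρ τ : ℝ} (hμ : 0 < μ) (hr : μ * ρ = 1)
    (hI : τ ∈ Icc (0 : ℝ) 1) :
    sR2 S x y τ ≤ 2 * μ * sN x y τ + 2 * ρ * sG x y τ := by
  have hx := h.hx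
  have hy := h.hy
  have hxm := hx.sm
  have hym := hy.sm
  have hxp := hx.sp
  have hyp := hy.sp
  have hS := h.St
  have hSp := h.St.sp
  have hSm := h.St.sm
  have gx := hx.dg
  have gy := hy.dg
  have d0 : Dec (fun τ β => (-2) * (((S (β - 1) - S β) * x τ (β - 1) - (S (β + 1) - S β) * x τ (β + 1)) * dg x τ β
    + ((S (β - 1) - S β) * y τ (β - 1) - (S (β + 1) - S β) * y τ (β + 1)) * dg y τ β)) := by
    repeat' first | assumption | exact Tmp.const _ | with_reducible apply Dec.add | with_reducible apply Dec.sub | with_reducible apply Dec.tmul | with_reducible apply Tmp.mul | with_reducible apply Tmp.add | with_reducible apply Tmp.sub | with_reducible apply Tmp.neg | with_reducible apply Dec.tmp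
  have da := h.dN.sm.add h.dN.sp
  have := Dec.tsum_le d0 ((da.c μ).add (h.dG.c (2 * ρ))) hI (by
    intro β
    have key : ∀ d a b : ℝ, |d| ≤ 1 → -2 * (d * a * b) ≤ μ * a ^ 2 + ρ * b ^ 2 := by
      intro d a b hd
      have h1 := young hμ hr (-d * a) b
      have h2 : d ^ 2 ≤ 1 := (sq_le_one_iff_abs_le_one d).2 hd
      have h3 : (-d * a) ^ 2 ≤ a ^ 2 := by nlinarith [mul_le_mul_of_nonneg_right h2 (sq_nonneg a)]
      nlinarith [mul_le_mul_of_nonneg_left h3 hμ.le]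
    have k1 := key _ (x τ (β - 1)) (dg x τ β) (h.Sm β)
    have k2 := key _ (-x τ (β + 1)) (dg x τ β) (h.Sp β)
    have k3 := key _ (y τ (β - 1)) (dg y τ β) (h.Sm β)
    have k4 := key _ (-y τ (β + 1)) (dg y τ β) (h.Sp β)
    linear_combination k1 + k2 + k3 + k4)
  rw [((da.c μ).summable hI).tsum_add ((h.dG.c (2 * ρ)).summable hI)] at this
  simp only [tsum_mul_left] at this
  rw [(h.dN.sm.summable hI).tsum_add (h.dN.sp.summable hI)] at this
  have em : ∑' β, (x τ (β - 1) ^ 2 + y τ (β - 1) ^ 2) = sN x y τ :=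
    tsum_shift (fun β => (x τ β ^ 2 + y τ β ^ 2)) (-1)
  have ep : ∑' β, (x τ (β + 1) ^ 2 + y τ (β + 1) ^ 2) = sN x y τ :=
    tsum_shift (fun β => (x τ β ^ 2 + y τ β ^ 2)) 1
  rw [em, ep] at this
  simp only [sR2, tsum_mul_left]
  change _ ≤ μ * (sN x y τ + sN x y τ) + 2 * ρ * sG x y τ at this
  linarith

lemma Sys.leN (h : Sys δ σ S x y) {μ ρ τ : ℝ} (hμ : 0 < μ) (hr : μ * ρ = 1)
    (hI : τ ∈ Icc (0 : ℝ) 1) :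
    sN x y τ ≤ μ * sP x y τ + ρ * sG x y τ + sG x y τ := by
  have hx := h.hx
  have hy := h.hy
  have d0 : Dec (fun τ β => (β : ℝ) * ((x τ (β - 1) ^ 2 + y τ (β - 1) ^ 2)
      - (x τ (β + 1) ^ 2 + y τ (β + 1) ^ 2))) :=
    Dec.tmul Tmp.cast (h.dN.sm.sub h.dN.sp)
  have e0 : ∑' β : ℤ, (β : ℝ) * ((x τ (β - 1) ^ 2 + y τ (β - 1) ^ 2)
      - (x τ (β + 1) ^ 2 + y τ (β + 1) ^ 2)) = 2 * sN x y τ := by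
    refine (tsum_tele (h.dN.c 2)
      (w := fun τ β => (β : ℝ) * (x τ (β - 1) ^ 2 + y τ (β - 1) ^ 2)
        + ((β : ℝ) - 1) * (x τ β ^ 2 + y τ β ^ 2))
      ((Dec.tmul Tmp.cast h.dN.sm).add (Dec.tmul (Tmp.cast.sub (Tmp.const 1)) h.dN)) hI ?_).trans ?_
    · intro β
      simp only [add_sub_cancel_right]
      push_cast
      ring
    · rw [tsum_mul_left]
      rfl
  have dn := h.dN.sm.add h.dN.sp
  have dp := h.dP.sm.add h.dP.sp
  have := Dec.tsum_le d0 (((dp.c (μ / 2)).add (dn.c (1 / 2))).add (h.dG.c (ρ + 1))) hI (by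
    intro β
    have k1 := young hμ hr (((β : ℝ) - 1) * x τ (β - 1)) (dg x τ β)
    have k2 := young hμ hr (((β : ℝ) - 1) * y τ (β - 1)) (dg y τ β)
    have k3 := young hμ hr (((β : ℝ) + 1) * x τ (β + 1)) (dg x τ β)
    have k4 := young hμ hr (((β : ℝ) + 1) * y τ (β + 1)) (dg y τ β)
    have l1 := young one_pos (one_mul 1) (x τ (β - 1)) (dg x τ β)
    have l2 := young one_pos (one_mul 1) (y τ (β - 1)) (dg y τ β)
    have l3 := young one_pos (one_mul 1) (-x τ (β + 1)) (dg x τ β)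
    have l4 := young one_pos (one_mul 1) (-y τ (β + 1)) (dg y τ β)
    push_cast
    have e : (β : ℝ) * ((x τ (β - 1) ^ 2 + y τ (β - 1) ^ 2) - (x τ (β + 1) ^ 2 + y τ (β + 1) ^ 2))
      = (((β : ℝ) - 1) * x τ (β - 1)) * dg x τ β + (((β : ℝ) - 1) * y τ (β - 1)) * dg y τ β
        + (((β : ℝ) + 1) * x τ (β + 1)) * dg x τ β + (((β : ℝ) + 1) * y τ (β + 1)) * dg y τ β
        + x τ (β - 1) * dg x τ β + y τ (β - 1) * dg y τ β
        + (-x τ (β + 1)) * dg x τ β + (-y τ (β + 1)) * dg y τ β := by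
      simp only [dg]
      ring
    rw [e]
    linarith)
  rw [e0, (((dp.c (μ / 2)).add (dn.c (1 / 2))).summable hI).tsum_add ((h.dG.c (ρ + 1)).summable hI),
    ((dp.c (μ / 2)).summable hI).tsum_add ((dn.c (1 / 2)).summable hI)] at this
  simp only [tsum_mul_left] at this
  rw [(h.dN.sm.summable hI).tsum_add (h.dN.sp.summable hI),
    (h.dP.sm.summable hI).tsum_add (h.dP.sp.summable hI)] at this
  have em : ∑' β, (x τ (β - 1) ^ 2 + y τ (β - 1) ^ 2) = sN x y τ :=
    tsum_shift (fun β => (x τ β ^ 2 + y τ β ^ 2)) (-1)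
  have ep : ∑' β, (x τ (β + 1) ^ 2 + y τ (β + 1) ^ 2) = sN x y τ :=
    tsum_shift (fun β => (x τ β ^ 2 + y τ β ^ 2)) 1
  have em2 : ∑' β : ℤ, ((β - 1 : ℤ) : ℝ) ^ 2 * (x τ (β - 1) ^ 2 + y τ (β - 1) ^ 2) = sP x y τ :=
    tsum_shift (fun β => (β : ℝ) ^ 2 * (x τ β ^ 2 + y τ β ^ 2)) (-1)
  have ep2 : ∑' β : ℤ, ((β + 1 : ℤ) : ℝ) ^ 2 * (x τ (β + 1) ^ 2 + y τ (β + 1) ^ 2) = sP x y τ :=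
    tsum_shift (fun β => (β : ℝ) ^ 2 * (x τ β ^ 2 + y τ β ^ 2)) 1
  rw [em, ep, em2, ep2] at this
  change 2 * sN x y τ ≤ μ / 2 * (sP x y τ + sP x y τ) + 1 / 2 * (sN x y τ + sN x y τ)
    + (ρ + 1) * sG x y τ at this
  linarith

lemma Sys.nn (h : Sys δ σ S x y) (τ : ℝ) : 0 ≤ sN x y τ ∧ 0 ≤ sP x y τ ∧ 0 ≤ sG x y τ ∧
    0 ≤ sN1 S x y τ ∧ 0 ≤ sP1 S x y τ ∧ 0 ≤ sG1 S x y τ := by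
  have hS : ∀ β, 0 ≤ S β := fun β => by linarith [h.S1 β]
  refine ⟨tsum_nonneg fun β => ?_, tsum_nonneg fun β => ?_, tsum_nonneg fun β => ?_,
    tsum_nonneg fun β => ?_, tsum_nonneg fun β => ?_, tsum_nonneg fun β => ?_⟩ <;>
  have := hS β <;> positivity
end

lemma scalar_ineq {τ n p Γ γ m ν5 u v w : ℝ} (hτ0 : 0 ≤ τ) (hn : 0 ≤ n) (hp : 0 ≤ p) (hΓ : 0 ≤ Γ)
    (hm : 0 ≤ m)
    (h1 : 2 * m ≤ 2 ^ 15 * n + p / 2 ^ 15) (h2 : 2 * u ≤ 2 ^ 13 * m + Γ / 2 ^ 13)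
    (h3 : v ≤ 16 * p + γ / 16 + 3 * n) (h4 : w ≤ 2 * Γ + 2 * ν5) (h5 : ν5 ≤ m + 2 * Γ) :
    ν5 / 2 ^ 45 + τ ^ 6 / 6 / 2 ^ 45 * (-2 * n) - 2 * n + 2 * m / 2 ^ 30 - 2 * p / 2 ^ 30
      + u / 2 ^ 30 - 3 * u / 2 ^ 40 - Γ / 2 ^ 41 + v / 2 ^ 40 + 4 * Γ / 2 ^ 45 - 2 * γ / 2 ^ 45
      + w / 2 ^ 45 ≤ 0 := by
  have : 0 ≤ τ ^ 6 * n := by positivity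
  linarith

section
variable {δ σ : ℝ} {S : ℤ → ℝ} {x y : ℝ → ℤ → ℝ}

lemma Sys.contract (h : Sys δ σ S x y) :
    (1 + 1 / 6 / 2 ^ 45) * sN x y 1 ≤ sN x y 0 ∧ ∀ τ ∈ Icc (0 : ℝ) 1, sN x y τ ≤ sN x y 0 := by
  obtain ⟨cN, dN⟩ := h.derivN
  obtain ⟨cP, dP⟩ := h.derivP
  obtain ⟨cY, dY⟩ := h.derivY
  obtain ⟨cG, dG⟩ := h.derivG
  have hδ := h.hδ
  have hδ0 := h.hδ.ne'
  have hσ := h.hσ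
  constructor
  · set F : ℝ → ℝ := fun τ => (1 + τ ^ 6 / 6 / 2 ^ 45) * sN x y τ + δ ^ 2 / 2 ^ 30 * τ ^ 2 * sP x y τ
      - σ / 2 ^ 40 * τ ^ 3 * sY x y τ + 1 / δ ^ 2 / 2 ^ 45 * τ ^ 4 * sG x y τ with hF
    have cF : ContinuousOn F (Icc 0 1) := by
      rw [hF]
      fun_prop
    have anti : AntitoneOn F (Icc 0 1) := by
      refine antitoneOn_of_hasDerivWithinAt_nonpos (convex_Icc 0 1) cF
        (f' := fun τ => ((6 * τ ^ 5) / 6 / 2 ^ 45 * sN x y τ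
          + (1 + τ ^ 6 / 6 / 2 ^ 45) * (-2 * δ * sN1 S x y τ)
          + (δ ^ 2 / 2 ^ 30 * (2 * τ) * sP x y τ
          + δ ^ 2 / 2 ^ 30 * τ ^ 2 * (-2 * δ * sP1 S x y τ + σ / δ ^ 2 * sY x y τ))
          - (σ / 2 ^ 40 * (3 * τ ^ 2) * sY x y τ
          + σ / 2 ^ 40 * τ ^ 3 * (σ / (2 * δ ^ 2) * sG x y τ + δ * sR1 S x y τ))
          + (1 / δ ^ 2 / 2 ^ 45 * (4 * τ ^ 3) * sG x y τ
          + 1 / δ ^ 2 / 2 ^ 45 * τ ^ 4 * (-2 * δ * sG1 S x y τ + δ * sR2 S x y τ)))) ?_ ?_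
      · intro τ hτ
        rw [interior_Icc] at hτ
        refine HasDerivAt.hasDerivWithinAt ?_
        have p6 : HasDerivAt (fun τ : ℝ => 1 + τ ^ 6 / 6 / 2 ^ 45) ((6 * τ ^ 5) / 6 / 2 ^ 45) τ := by
          simpa using (((hasDerivAt_pow 6 τ).div_const 6).div_const (2 ^ 45)).const_add 1
        have p2 : HasDerivAt (fun τ : ℝ => δ ^ 2 / 2 ^ 30 * τ ^ 2) (δ ^ 2 / 2 ^ 30 * (2 * τ)) τ := by
          simpa using (hasDerivAt_pow 2 τ).const_mul (δ ^ 2 / 2 ^ 30)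
        have p3 : HasDerivAt (fun τ : ℝ => σ / 2 ^ 40 * τ ^ 3) (σ / 2 ^ 40 * (3 * τ ^ 2)) τ := by
          simpa using (hasDerivAt_pow 3 τ).const_mul (σ / 2 ^ 40)
        have p4 : HasDerivAt (fun τ : ℝ => 1 / δ ^ 2 / 2 ^ 45 * τ ^ 4)
            (1 / δ ^ 2 / 2 ^ 45 * (4 * τ ^ 3)) τ := by
          have := (hasDerivAt_pow 4 τ).const_mul (1 / δ ^ 2 / 2 ^ 45)
          exact this.congr_deriv (by norm_num)
        exact (((p6.mul (dN τ hτ)).add (p2.mul (dP τ hτ))).sub (p3.mul (dY τ hτ))).add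
          (p4.mul (dG τ hτ))
      · intro τ hτ
        rw [interior_Icc] at hτ
        have hI := Ioo_subset_Icc_self hτ
        have ht : 0 < τ := hτ.1
        have ht0 := ht.ne'
        have ht1 : τ ≤ 1 := hI.2
        obtain ⟨n0, n1, n2, n3, n4, n5⟩ := h.nn τ
        have e1 := h.leP (μ := 2 ^ 15 / (δ * τ)) (ρ := δ * τ / 2 ^ 15) (by positivity)
          (by field_simp) hI
        have e2 := h.leY (s := σ) (μ := 2 ^ 13 * δ ^ 2 / τ) (ρ := τ / (2 ^ 13 * δ ^ 2)) hσ
          (by positivity) (by field_simp) hI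
        have e3 := h.leR1 (s := -σ) (μ := 16 * δ ^ 2 / τ) (ρ := τ / (16 * δ ^ 2)) (by linarith)
          (by positivity) (by field_simp) hI
        have e4 := h.leR2 (μ := τ * δ) (ρ := 1 / (τ * δ)) (by positivity) (by field_simp) hI
        have e5 := h.leN (μ := δ ^ 2 / τ) (ρ := τ / δ ^ 2) (by positivity) (by field_simp) hI
        generalize sN x y τ = N at *
        generalize sP x y τ = P at *
        generalize sY x y τ = Y at *
        generalize sG x y τ = G at *
        generalize sN1 S x y τ = N1 at *
        generalize sP1 S x y τ = P1 at *
        generalize sG1 S x y τ = G1 at *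
        generalize sR1 S x y τ = R1 at *
        generalize sR2 S x y τ = R2 at *
        have key := scalar_ineq (τ := τ) (n := δ * N1) (p := δ ^ 3 * τ ^ 2 * P1)
          (Γ := τ ^ 3 * G / δ ^ 2) (γ := τ ^ 4 * G1 / δ) (m := δ ^ 2 * τ * P) (ν5 := τ ^ 5 * N)
          (u := τ ^ 2 * (σ * Y)) (v := τ ^ 3 * δ * (-σ * R1)) (w := τ ^ 4 / δ * R2) ht.le
          (by positivity) (by positivity) (by positivity) (by positivity)
          (by
            have := mul_le_mul_of_nonneg_left e1 (by positivity : 0 ≤ δ ^ 2 * τ)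
            refine le_trans (le_of_eq ?_) (this.trans (le_of_eq ?_))
            · ring
            · field_simp)
          (by
            have := mul_le_mul_of_nonneg_left e2 (by positivity : 0 ≤ τ ^ 2)
            refine le_trans (le_of_eq ?_) (this.trans (le_of_eq ?_))
            · ring
            · field_simp)
          (by
            have := mul_le_mul_of_nonneg_left e3 (by positivity : 0 ≤ τ ^ 3 * δ)
            have t3 : τ ^ 3 * (δ * N1) ≤ δ * N1 := by
              have : τ ^ 3 ≤ 1 := pow_le_one₀ ht.le ht1
              have h9 : 0 ≤ δ * N1 := by positivity
              nlinarith
            refine this.trans ?_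
            have e : τ ^ 3 * δ * (16 * δ ^ 2 / τ * P1 + τ / (16 * δ ^ 2) * G1 + 3 * N1)
              = 16 * (δ ^ 3 * τ ^ 2 * P1) + τ ^ 4 * G1 / δ / 16 + 3 * (τ ^ 3 * (δ * N1)) := by
              field_simp
            rw [e]
            linarith)
          (by
            have := mul_le_mul_of_nonneg_left e4 (by positivity : 0 ≤ τ ^ 4 / δ)
            refine this.trans (le_of_eq ?_)
            field_simp
            ring)
          (by
            have := mul_le_mul_of_nonneg_left e5 (by positivity : 0 ≤ τ ^ 5)
            refine this.trans ?_
            have e : τ ^ 5 * (δ ^ 2 / τ * P + τ / δ ^ 2 * G + G) = τ ^ 3 * (δ ^ 2 * τ * P)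
              + τ ^ 3 * (τ ^ 3 * G / δ ^ 2) + (τ ^ 2 * δ ^ 2) * (τ ^ 3 * G / δ ^ 2) := by
              field_simp
            rw [e]
            have a1 : τ ^ 3 ≤ 1 := pow_le_one₀ ht.le ht1
            have a2 : τ ^ 2 ≤ 1 := pow_le_one₀ ht.le ht1
            have a3 : δ ^ 2 ≤ 1 := pow_le_one₀ hδ.le h.hδ1
            have a4 : τ ^ 2 * δ ^ 2 ≤ 1 := mul_le_one₀ a2 (by positivity) a3
            have b1 : 0 ≤ δ ^ 2 * τ * P := by positivity
            have b2 : 0 ≤ τ ^ 3 * G / δ ^ 2 := by positivity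
            nlinarith [mul_le_mul_of_nonneg_right a1 b1, mul_le_mul_of_nonneg_right a1 b2,
              mul_le_mul_of_nonneg_right a4 b2])
        refine le_trans (le_of_eq ?_) key
        field_simp
        linear_combination (-(6 * τ ^ 3 * 2 ^ 4 * G)) * hσ
    have hle := anti (left_mem_Icc.2 zero_le_one) (right_mem_Icc.2 zero_le_one) zero_le_one
    have e := h.leY (s := σ) (μ := 2 ^ 10 * δ ^ 2) (ρ := 1 / (2 ^ 10 * δ ^ 2)) hσ
          (by positivity) (by field_simp) (right_mem_Icc.2 zero_le_one)
    obtain ⟨n0, n1, n2, n3, n4, n5⟩ := h.nn 1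
    have q1 : 0 ≤ δ ^ 2 * sP x y 1 := by positivity
    have q2 : 0 ≤ sG x y 1 / δ ^ 2 := by positivity
    have e' : 2 * (σ * sY x y 1) ≤ 2 ^ 10 * (δ ^ 2 * sP x y 1) + sG x y 1 / δ ^ 2 / 2 ^ 10 := by
      refine e.trans (le_of_eq ?_)
      field_simp
    have f1 : F 1 = (1 + 1 / 6 / 2 ^ 45) * sN x y 1 + (δ ^ 2 * sP x y 1) / 2 ^ 30
      - (σ * sY x y 1) / 2 ^ 40 + sG x y 1 / δ ^ 2 / 2 ^ 45 := by
      simp only [hF]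
      ring
    have f0 : F 0 = sN x y 0 := by simp [hF]
    rw [f1, f0] at hle
    linarith
  · intro τ hτ
    have anti : AntitoneOn (sN x y) (Icc 0 1) := by
      refine antitoneOn_of_hasDerivWithinAt_nonpos (convex_Icc 0 1) cN
        (f' := fun τ => -2 * δ * sN1 S x y τ) ?_ ?_
      · intro τ hτ
        rw [interior_Icc] at hτ
        exact (dN τ hτ).hasDerivWithinAt
      · intro τ _
        have := (h.nn τ).2.2.2.1
        have : 0 ≤ δ * sN1 S x y τ := by positivity
        linarith
    exact anti (left_mem_Icc.2 zero_le_one) hτ hτ.1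
end

lemma Sv_facts (α : ℝ) (hα : 1 ≤ |α|) : (∀ β, 1 ≤ Sv α β) ∧ (∀ β : ℤ, |(β : ℝ)| ≤ Sv α β) ∧
    (∀ β : ℤ, |Sv α (β + 1) - Sv α β| ≤ 1) ∧ (∀ β : ℤ, Sv α β ≤ |α| + |(β : ℝ)|) := by
  have hb : ∀ β : ℤ, |(β : ℝ)| ≤ Sv α β := fun β =>
    Real.abs_le_sqrt (by nlinarith [sq_nonneg α])
  have ha : ∀ β : ℤ, |α| ≤ Sv α β := fun β =>
    Real.abs_le_sqrt (by nlinarith [sq_nonneg (β : ℝ)])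
  have hs : ∀ β : ℤ, Sv α β ^ 2 = α ^ 2 + (β : ℝ) ^ 2 := fun β =>
    Real.sq_sqrt (by positivity)
  refine ⟨fun β => hα.trans (ha β), hb, fun β => ?_, fun β => ?_⟩
  · have h1 := hs (β + 1)
    have h2 := hs β
    push_cast at h1
    have b1 := hb (β + 1)
    have b2 := hb β
    push_cast at b1
    have p1 := hα.trans (ha (β + 1))
    have p2 := hα.trans (ha β)
    rw [abs_le] at b1 b2 ⊢
    constructor
    · by_contra hc
      push Not at hc
      nlinarith
    · by_contra hc
      push Not at hc
      nlinarith
  · refine Real.sqrt_le_iff.2 ⟨by positivity, ?_⟩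
    have := sq_abs α
    have := sq_abs (β : ℝ)
    nlinarith [mul_nonneg (abs_nonneg α) (abs_nonneg (β : ℝ))]

lemma dec_of_rd {θ : ℝ → ℤ → ℂ} (hθ : RapidlyDecaying θ) {s T : ℝ} (hs : 0 ≤ s) (hT : 0 < T)
    {x : ℝ → ℤ → ℝ} (hx : ∀ τ β, |x τ β| ≤ ‖θ (s + τ * T) β‖) : Dec x := by
  intro k
  obtain ⟨M, hM⟩ := hθ k (s + T) (by linarith)
  have key : ∀ τ ∈ Icc (0 : ℝ) 1, ∀ β : ℤ,
      ((1 + |(β : ℝ)|) ^ k * |x τ β|) ^ 2 ≤ 2 ^ k * M := by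
    intro τ hτ β
    obtain ⟨h1, h2⟩ := hM (s + τ * T) (by have := mul_nonneg hτ.1 hT.le; linarith)
      (by nlinarith [hτ.2])
    have h3 := h1.le_tsum β (fun j _ => by positivity)
    have h4 := h3.trans h2
    have e1 : (1 + |(β : ℝ)|) ^ 2 ≤ 2 * (1 + (β : ℝ) ^ 2) := by
      rw [← sq_abs (β : ℝ)]
      nlinarith [sq_nonneg (1 - |(β : ℝ)|)]
    calc ((1 + |(β : ℝ)|) ^ k * |x τ β|) ^ 2 = ((1 + |(β : ℝ)|) ^ 2) ^ k * |x τ β| ^ 2 := by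
          rw [mul_pow, ← pow_mul, ← pow_mul, mul_comm k 2]
      _ ≤ (2 * (1 + (β : ℝ) ^ 2)) ^ k * ‖θ (s + τ * T) β‖ ^ 2 := by
        gcongr
        exact hx τ β
      _ = 2 ^ k * ((1 + (β : ℝ) ^ 2) ^ k * ‖θ (s + τ * T) β‖ ^ 2) := by rw [mul_pow]; ring
      _ ≤ 2 ^ k * M := by gcongr
  exact ⟨Real.sqrt (2 ^ k * M), Real.sqrt_nonneg _, fun τ hτ β => Real.le_sqrt_of_sq_le (key τ hτ β)⟩

lemma mkSys {α ν δ σ T s : ℝ} {θ : ℝ → ℤ → ℂ} (hα : 1 ≤ |α|) (hθ : RapidlyDecaying θ)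
    (hE : TransportFracDiff α ν θ) (hs : 0 ≤ s) (hT : 0 < T) (hδ : 0 < δ) (hδ1 : δ ≤ 1)
    (hσ : σ * σ = 1) (e1 : ν * T = δ) (e2 : α * T = σ / δ ^ 2) :
    Sys δ σ (Sv α) (fun τ β => (θ (s + τ * T) β).re) (fun τ β => (θ (s + τ * T) β).im) := by
  obtain ⟨s1, s2, s3, s4⟩ := Sv_facts α hα
  have hd : ∀ τ β, HasDerivAt (fun r : ℝ => θ (s + r * T) β)
      ((T : ℂ) * (-((ν * Sv α β : ℝ) : ℂ) * θ (s + τ * T) β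
        - Complex.I * (α : ℂ) / 2 * (θ (s + τ * T) (β - 1) + θ (s + τ * T) (β + 1)))) τ := by
    intro τ β
    have a : HasDerivAt (fun r : ℝ => s + r * T) T τ := by
      simpa using ((hasDerivAt_id τ).mul_const T).const_add s
    have := HasDerivAt.scomp τ (hE (s + τ * T) β) a
    simpa [Function.comp_def] using this
  have e3 : σ / (2 * δ ^ 2) = α * T / 2 := by
    rw [e2]; ring
  refine ⟨hδ, hδ1, hσ, s1, s2, s3, fun β => ?_, ⟨|α| + 1, 1, by positivity, fun τ _ β => ?_⟩,
    dec_of_rd hθ hs hT fun τ β => Complex.abs_re_le_norm _,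
    dec_of_rd hθ hs hT fun τ β => Complex.abs_im_le_norm _, fun τ β => ?_, fun τ β => ?_⟩
  · have := s3 (β - 1)
    rw [sub_add_cancel, abs_sub_comm] at this
    exact this
  · rw [abs_of_nonneg (zero_le_one.trans (s1 β))]
    have := s4 β
    nlinarith [mul_nonneg (abs_nonneg α) (abs_nonneg (β : ℝ)), abs_nonneg (β : ℝ)]
  · have := Complex.reCLM.hasFDerivAt.comp_hasDerivAt τ (hd τ β)
    refine HasDerivAt.congr_deriv this ?_
    rw [e3, ← e1]
    simp
    ring
  · have := Complex.imCLM.hasFDerivAt.comp_hasDerivAt τ (hd τ β)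
    refine HasDerivAt.congr_deriv this ?_
    rw [e3, ← e1]
    simp
    ring

lemma step {α ν δ σ T : ℝ} {θ : ℝ → ℤ → ℂ} (hα : 1 ≤ |α|) (hθ : RapidlyDecaying θ)
    (hE : TransportFracDiff α ν θ) (hT : 0 < T) (hδ : 0 < δ) (hδ1 : δ ≤ 1)
    (hσ : σ * σ = 1) (e1 : ν * T = δ) (e2 : α * T = σ / δ ^ 2) (s : ℝ) (hs : 0 ≤ s) :
    (1 + 1 / 6 / 2 ^ 45) * (∑' β : ℤ, ‖θ (s + T) β‖ ^ 2) ≤ ∑' β : ℤ, ‖θ s β‖ ^ 2 ∧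
    ∀ τ ∈ Icc (0 : ℝ) 1, (∑' β : ℤ, ‖θ (s + τ * T) β‖ ^ 2) ≤ ∑' β : ℤ, ‖θ s β‖ ^ 2 := by
  have h := (mkSys hα hθ hE hs hT hδ hδ1 hσ e1 e2).contract
  have e : ∀ τ, sN (fun τ β => (θ (s + τ * T) β).re) (fun τ β => (θ (s + τ * T) β).im) τ
      = ∑' β : ℤ, ‖θ (s + τ * T) β‖ ^ 2 := by
    intro τ
    unfold sN
    refine tsum_congr fun β => ?_
    rw [Complex.sq_norm, Complex.normSq_apply]
    ring
  simp only [e] at h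
  simpa using h

lemma iter {α ν δ σ T : ℝ} {θ : ℝ → ℤ → ℂ} (hα : 1 ≤ |α|) (hθ : RapidlyDecaying θ)
    (hE : TransportFracDiff α ν θ) (hT : 0 < T) (hδ : 0 < δ) (hδ1 : δ ≤ 1)
    (hσ : σ * σ = 1) (e1 : ν * T = δ) (e2 : α * T = σ / δ ^ 2) (n : ℕ) :
    (1 + 1 / 6 / 2 ^ 45) ^ n * (∑' β : ℤ, ‖θ (n * T) β‖ ^ 2) ≤ ∑' β : ℤ, ‖θ 0 β‖ ^ 2 := by
  induction n with
  | zero => simp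
  | succ n ih =>
    have h := (step hα hθ hE hT hδ hδ1 hσ e1 e2 (n * T) (by positivity)).1
    refine le_trans ?_ ih
    have e : ((n + 1 : ℕ) : ℝ) * T = n * T + T := by push_cast; ring
    rw [e, pow_succ, mul_assoc]
    exact mul_le_mul_of_nonneg_left h (by positivity)

theorem transport_frac_diff_enhanced_dissipation (c₀ : ℝ) (hc₀ : 1 < c₀) :
    ∃ ν₀ c C : ℝ, 0 < ν₀ ∧ ν₀ ≤ 1 ∧ 0 < c ∧ 1 < C ∧
      ∀ ν : ℝ, 0 < ν → ν < ν₀ → ∀ α : ℝ, c₀ ≤ |α| →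
      ∀ θ : ℝ → ℤ → ℂ, RapidlyDecaying θ → TransportFracDiff α ν θ →
      ∀ t : ℝ, 0 ≤ t →
        (∑' β : ℤ, ‖θ t β‖ ^ 2) ≤
          C ^ 2 * Real.exp (-2 * c * ν ^ ((2 : ℝ) / 3) * t) * ∑' β : ℤ, ‖θ 0 β‖ ^ 2 := by
  have hp1 : (1 : ℝ) < 1 + 1 / 6 / 2 ^ 45 := by norm_num
  obtain ⟨p, hp⟩ : ∃ p : ℝ, p = 1 + 1 / 6 / 2 ^ 45 := ⟨_, rfl⟩
  rw [← hp] at hp1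
  have hp0 : 0 < p := by linarith
  have hl : 0 < Real.log p := Real.log_pos hp1
  refine ⟨1, Real.log p / 2, p, one_pos, le_rfl, by positivity, hp1, ?_⟩
  intro ν hν hν1 α hα θ hθ hE t ht
  have hA : 1 ≤ |α| := hc₀.le.trans hα
  have hA0 : 0 < |α| := by linarith
  have hα0 : α ≠ 0 := abs_pos.1 hA0
  obtain ⟨δ, hδd⟩ : ∃ δ : ℝ, δ = (ν / |α|) ^ ((1 : ℝ) / 3) := ⟨_, rfl⟩
  have hq : 0 < ν / |α| := by positivity
  have hδ : 0 < δ := by rw [hδd]; positivity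
  have hδ1 : δ ≤ 1 := by
    rw [hδd]
    exact Real.rpow_le_one hq.le ((div_le_one hA0).2 (by linarith)) (by norm_num)
  have hδ3 : δ ^ 3 = ν / |α| := by
    rw [hδd, ← Real.rpow_natCast, ← Real.rpow_mul hq.le]
    norm_num
  have hν3 : ν = δ ^ 3 * |α| := by
    rw [hδ3]; field_simp
  obtain ⟨T, hTd⟩ : ∃ T : ℝ, T = 1 / (|α| * δ ^ 2) := ⟨_, rfl⟩
  have hT : 0 < T := by rw [hTd]; positivity
  have hσ : α / |α| * (α / |α|) = 1 := by
    rw [div_mul_div_comm, abs_mul_abs_self]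
    exact div_self (mul_self_ne_zero.2 hα0)
  have e1 : ν * T = δ := by
    rw [hTd, hν3]; field_simp
  have e2 : α * T = α / |α| / δ ^ 2 := by
    rw [hTd]; field_simp
  have hr : ν ^ ((2 : ℝ) / 3) ≤ 1 / T := by
    have h1 : ν ^ ((2 : ℝ) / 3) = δ ^ 2 * |α| ^ ((2 : ℝ) / 3) := by
      rw [hν3, Real.mul_rpow (by positivity) (by positivity), ← Real.rpow_natCast,
        ← Real.rpow_mul hδ.le, ← Real.rpow_natCast]
      norm_num
    have h2 : |α| ^ ((2 : ℝ) / 3) ≤ |α| := by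
      calc |α| ^ ((2 : ℝ) / 3) ≤ |α| ^ (1 : ℝ) := Real.rpow_le_rpow_of_exponent_le hA (by norm_num)
        _ = |α| := Real.rpow_one _
    rw [h1, hTd, one_div_one_div, mul_comm |α|]
    gcongr
  obtain ⟨n, hn⟩ : ∃ n : ℕ, n = ⌊t / T⌋₊ := ⟨_, rfl⟩
  have hn1 : (n : ℝ) ≤ t / T := by rw [hn]; exact Nat.floor_le (by positivity)
  have hn2 : t / T < n + 1 := by rw [hn]; exact Nat.lt_floor_add_one _
  have hit := iter hA hθ hE hT hδ hδ1 hσ e1 e2 n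
  have hst := (step hA hθ hE hT hδ hδ1 hσ e1 e2 (n * T) (by positivity)).2 (t / T - n)
    ⟨by linarith, by linarith⟩
  have et : n * T + (t / T - n) * T = t := by field_simp; ring
  rw [et] at hst
  rw [← hp] at hit
  have hN0 : 0 ≤ ∑' β : ℤ, ‖θ 0 β‖ ^ 2 := tsum_nonneg fun _ => by positivity
  have hpn : 0 < p ^ n := by positivity
  have hfac : 1 ≤ p ^ n * (p ^ 2 * Real.exp (-2 * (Real.log p / 2) * ν ^ ((2 : ℝ) / 3) * t)) := by
    have hpe : ∀ k : ℕ, p ^ k = Real.exp (k * Real.log p) := fun k => by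
      rw [mul_comm, Real.exp_mul, Real.exp_log hp0, Real.rpow_natCast]
    rw [hpe n, hpe 2, ← Real.exp_add, ← Real.exp_add]
    refine Real.one_le_exp ?_
    have h1 : ν ^ ((2 : ℝ) / 3) * t ≤ n + 1 := by
      have := mul_le_mul_of_nonneg_right hr ht
      have e : 1 / T * t = t / T := by ring
      linarith
    have h2 := mul_le_mul_of_nonneg_left h1 hl.le
    push_cast
    nlinarith
  refine hst.trans ?_
  refine le_of_mul_le_mul_left ?_ hpn
  refine hit.trans ?_
  rw [← mul_assoc]
  exact le_mul_of_one_le_left hN0 hfac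
end

section
/- Let c₀ > 1. There exists a constant c₂ > 0 depending only on c₀ such that for every real α with |α| ≥ c₀ and every rapidly decaying θ : ℤ → ℂ, setting u(β) = (1 − S(β)^{−1}) θ(β), one has | Σ_β β · (1−2β)/(S(β−1)+S(β)) · Im(u(β) conj(u(β−1))) − Σ_β β · (1+2β)/(S(β+1)+S(β)) · Im(u(β) conj(u(β+1))) | ≤ c₂ Σ_β (S(β) − 1) |θ(β)|². -/
/-- A sequence `θ : ℤ → ℂ` is rapidly decaying if `Σ_β (1+β²)^k |θ(β)|² < ∞` for all `k`. -/
def RapidlyDecayingSeq (θ : ℤ → ℂ) : Prop :=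
  ∀ k : ℕ, Summable (fun β : ℤ => (1 + (β : ℝ) ^ 2) ^ k * ‖θ β‖ ^ 2)

/-- `u(β) = (1 − S(β)⁻¹) θ(β)`. -/
noncomputable def useq (α : ℝ) (θ : ℤ → ℂ) (β : ℤ) : ℂ :=
  (1 - ((Sv α β : ℝ) : ℂ)⁻¹) * θ β

theorem Sv_gt_one (α : ℝ) (h : 1 < |α|) (β : ℤ) : 1 < Sv α β := by
  unfold Sv
  apply Real.lt_sqrt_of_sq_lt
  have : 1 < α ^ 2 := by rw [← sq_abs]; nlinarith
  nlinarith [sq_nonneg (β : ℝ)]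

theorem abs_le_Sv (α : ℝ) (β : ℤ) : |(β : ℝ)| ≤ Sv α β := by
  unfold Sv
  apply Real.abs_le_sqrt
  nlinarith [sq_nonneg α]

theorem Sv_mul_useq (α : ℝ) (h : 1 < |α|) (θ : ℤ → ℂ) (β : ℤ) :
    Sv α β * ‖useq α θ β‖ ^ 2 ≤ (Sv α β - 1) * ‖θ β‖ ^ 2 := by
  have h1 := Sv_gt_one α h β
  have h0 : 0 < Sv α β := by linarith
  have hn : ‖useq α θ β‖ = |1 - (Sv α β)⁻¹| * ‖θ β‖ := by
    unfold useq
    rw [norm_mul, ← Complex.ofReal_inv, ← Complex.ofReal_one, ← Complex.ofReal_sub,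
      Complex.norm_real, Real.norm_eq_abs]
  rw [hn, mul_pow, sq_abs, ← mul_assoc]
  apply mul_le_mul_of_nonneg_right _ (sq_nonneg _)
  have e : Sv α β * (1 - (Sv α β)⁻¹) ^ 2 = (Sv α β - 1) * (1 - (Sv α β)⁻¹) := by
    field_simp
  rw [e]
  have : 0 < (Sv α β)⁻¹ := by positivity
  nlinarith

theorem energy_summable (α : ℝ) (h : 1 < |α|) (θ : ℤ → ℂ) (hθ : RapidlyDecayingSeq θ) :
    Summable (fun β : ℤ => (Sv α β - 1) * ‖θ β‖ ^ 2) := by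
  refine Summable.of_nonneg_of_le (fun β => ?_) (fun β => ?_) ((hθ 1).mul_left (1 + |α|))
  · have := Sv_gt_one α h β
    exact mul_nonneg (by linarith) (sq_nonneg _)
  · rw [← mul_assoc]
    apply mul_le_mul_of_nonneg_right _ (sq_nonneg _)
    have : Sv α β ≤ |α| + |(β : ℝ)| := by
      unfold Sv
      apply Real.sqrt_le_iff.2 ⟨by positivity, ?_⟩
      rw [← sq_abs α, ← sq_abs (β : ℝ)]
      nlinarith [mul_nonneg (abs_nonneg α) (abs_nonneg (β : ℝ))]
    have h2 : |(β : ℝ)| ≤ 1 + (β : ℝ) ^ 2 := by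
      rw [← sq_abs (β : ℝ)]; nlinarith [sq_nonneg (|(β : ℝ)| - 1)]
    have h3 : 0 ≤ |α| * (β : ℝ) ^ 2 := by positivity
    rw [pow_one]
    nlinarith

theorem term_bound (α : ℝ) (h : 1 < |α|) (θ : ℤ → ℂ) (b b' : ℤ) (c : ℝ)
    (hb : |(b : ℝ)| ≤ |(b' : ℝ)| + 1) (hc : |c| ≤ |(b : ℝ)| + |(b' : ℝ)|) :
    ‖(b : ℝ) * (c / (Sv α b' + Sv α b)) *
      (useq α θ b * (starRingEnd ℂ) (useq α θ b')).im‖ ≤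
      1 / 2 * ((Sv α b - 1) * ‖θ b‖ ^ 2) + (Sv α b' - 1) * ‖θ b'‖ ^ 2 := by
  have h1 := Sv_gt_one α h b
  have h1' := Sv_gt_one α h b'
  have h2 := abs_le_Sv α b
  have h2' := abs_le_Sv α b'
  have h3 := Sv_mul_useq α h θ b
  have h3' := Sv_mul_useq α h θ b'
  have him : |(useq α θ b * (starRingEnd ℂ) (useq α θ b')).im| ≤
      ‖useq α θ b‖ * ‖useq α θ b'‖ := by
    refine (Complex.abs_im_le_norm _).trans ?_
    rw [norm_mul, RCLike.norm_conj]
  have hq : |c / (Sv α b' + Sv α b)| ≤ 1 := by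
    rw [abs_div, abs_of_pos (by linarith : 0 < Sv α b' + Sv α b)]
    apply (div_le_one (by linarith)).2
    linarith
  rw [Real.norm_eq_abs, abs_mul, abs_mul]
  have hA : |(b : ℝ)| * |c / (Sv α b' + Sv α b)| ≤ |(b : ℝ)| :=
    mul_le_of_le_one_right (abs_nonneg _) hq
  have hB := mul_le_mul hA him (abs_nonneg _) (abs_nonneg _)
  have hC : |(b : ℝ)| * (‖useq α θ b‖ * ‖useq α θ b'‖) ≤
      |(b : ℝ)| * (1 / 2 * ‖useq α θ b‖ ^ 2 + 1 / 2 * ‖useq α θ b'‖ ^ 2) :=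
    mul_le_mul_of_nonneg_left
      (by nlinarith [sq_nonneg (‖useq α θ b‖ - ‖useq α θ b'‖)]) (abs_nonneg _)
  have hD : |(b : ℝ)| * ‖useq α θ b‖ ^ 2 ≤ Sv α b * ‖useq α θ b‖ ^ 2 :=
    mul_le_mul_of_nonneg_right h2 (sq_nonneg _)
  have hE : |(b : ℝ)| * ‖useq α θ b'‖ ^ 2 ≤ (2 * Sv α b') * ‖useq α θ b'‖ ^ 2 :=
    mul_le_mul_of_nonneg_right (by linarith) (sq_nonneg _)
  linarith

theorem sum_bound (f g : ℤ → ℝ) (hg : Summable g) (s : ℤ)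
    (h : ∀ β, ‖f β‖ ≤ 1 / 2 * g β + g (β + s)) : |∑' β, f β| ≤ 3 / 2 * ∑' β, g β := by
  have h1 : HasSum (fun β => g (β + s)) (∑' β, g β) :=
    (Equiv.hasSum_iff (Equiv.addRight s)).2 hg.hasSum
  have h2 := (hg.hasSum.mul_left (1 / 2)).add h1
  have h3 := tsum_of_norm_bounded h2 h
  rw [Real.norm_eq_abs] at h3
  linarith

theorem commutator_lower_order_bound (c₀ : ℝ) (hc₀ : 1 < c₀) :
    ∃ c₂ : ℝ, 0 < c₂ ∧
      ∀ α : ℝ, c₀ ≤ |α| → ∀ θ : ℤ → ℂ, RapidlyDecayingSeq θ →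
        |(∑' β : ℤ, (β : ℝ) * ((1 - 2 * (β : ℝ)) / (Sv α (β - 1) + Sv α β)) *
              (useq α θ β * (starRingEnd ℂ) (useq α θ (β - 1))).im)
          - ∑' β : ℤ, (β : ℝ) * ((1 + 2 * (β : ℝ)) / (Sv α (β + 1) + Sv α β)) *
              (useq α θ β * (starRingEnd ℂ) (useq α θ (β + 1))).im|
          ≤ c₂ * ∑' β : ℤ, (Sv α β - 1) * ‖θ β‖ ^ 2 := by
  refine ⟨3, by norm_num, fun α hα θ hθ => ?_⟩
  have h : 1 < |α| := by linarith
  have hs := energy_summable α h θ hθ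
  have A := sum_bound (fun β : ℤ => (β : ℝ) * ((1 - 2 * (β : ℝ)) / (Sv α (β - 1) + Sv α β)) *
              (useq α θ β * (starRingEnd ℂ) (useq α θ (β - 1))).im) _ hs (-1) (fun β => by
    refine term_bound α h θ β (β - 1) _ ?_ ?_
    · push_cast
      have := abs_add_le ((β : ℝ) - 1) 1
      simpa using this
    · push_cast
      have := abs_add_le (-(β : ℝ)) (-((β : ℝ) - 1))
      rw [abs_neg, abs_neg] at this
      rw [show -(β : ℝ) + -((β : ℝ) - 1) = 1 - 2 * (β : ℝ) by ring] at this
      exact this)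
  have B := sum_bound (fun β : ℤ => (β : ℝ) * ((1 + 2 * (β : ℝ)) / (Sv α (β + 1) + Sv α β)) *
              (useq α θ β * (starRingEnd ℂ) (useq α θ (β + 1))).im) _ hs 1 (fun β => by
    refine term_bound α h θ β (β + 1) _ ?_ ?_
    · push_cast
      have := abs_add_le ((β : ℝ) + 1) (-1)
      simpa using this
    · push_cast
      have := abs_add_le (β : ℝ) ((β : ℝ) + 1)
      rw [show (β : ℝ) + ((β : ℝ) + 1) = 1 + 2 * (β : ℝ) by ring] at this
      exact this)
  rw [abs_le] at A B ⊢
  constructor <;> linarith [A.1, A.2, B.1, B.2]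
end
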